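/- arXiv:1609.07178 — 3 statements merged into one kernel-verified Lean document; each statement's English description precedes it below -/
import Mathlib

section
/- Let V be a nonzero finite-dimensional real normed vector space and T : V → V a linear endomorphism such that V is the internal direct sum of the maximal generalized eigenspaces V(μ) = ⋃_k ker((T − μ)^k) of T over μ ranging in a finite set σ of positive real numbers (so all eigenvalues of T are real and positive and T is triangularizable over ℝ). Let λ = max σ and let π_λ : V → V(λ) be the projection onto V(λ) determined by this direct sum decomposition. If v ∈ V satisfies π_λ(v) ≠ 0, then T^n v ≠ 0 for every n ∈ ℕ, and every cluster point of the sequence ([T^n v])_{n∈ℕ} in ℙ(V) lies in ℙ(V(λ)), i.e., the line it represents is contained in V(λ). -/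
open Filter Topology Module

noncomputable instance {V : Type*} [NormedAddCommGroup V] [NormedSpace ℝ V] :
    TopologicalSpace (Projectivization ℝ V) :=
  inferInstanceAs (TopologicalSpace (Quotient (projectivizationSetoid ℝ V)))

section GrowthOfIterates

variable {V : Type*} [NormedAddCommGroup V] [NormedSpace ℝ V]

theorem exists_norm_pow_apply_le (T : V →ₗ[ℝ] V) {μ r : ℝ} (hμ : 0 ≤ μ) (hr : μ < r) (k : ℕ) :
    ∀ x : V, ((T - μ • (1 : End ℝ V)) ^ k) x = 0 →
      ∃ C : ℝ, ∀ n : ℕ, ‖(T ^ n) x‖ ≤ C * r ^ n := by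
  induction k with
  | zero => exact fun x hx => ⟨0, fun n => by simp_all⟩
  | succ k ih =>
    intro x hx
    obtain ⟨B, hB⟩ := ih ((T - μ • (1 : End ℝ V)) x) (by rwa [pow_succ] at hx)
    have hrμ : 0 < r - μ := sub_pos.2 hr
    refine ⟨max ‖x‖ (B / (r - μ)), fun n => ?_⟩
    have hBC : B ≤ max ‖x‖ (B / (r - μ)) * (r - μ) :=
      (div_le_iff₀ hrμ).1 (le_max_right _ _)
    have hxC : ‖x‖ ≤ max ‖x‖ (B / (r - μ)) := le_max_left _ _
    generalize max ‖x‖ (B / (r - μ)) = C at hBC hxC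
    induction n with
    | zero => simpa using hxC
    | succ n ihn =>
      have hrec : (T ^ (n + 1)) x = μ • (T ^ n) x + (T ^ n) ((T - μ • (1 : End ℝ V)) x) := by
        simp [pow_succ]
      have hrn : 0 ≤ r ^ n := pow_nonneg (hμ.trans hr.le) n
      calc ‖(T ^ (n + 1)) x‖
          ≤ ‖μ • (T ^ n) x‖ + ‖(T ^ n) ((T - μ • (1 : End ℝ V)) x)‖ := hrec ▸ norm_add_le _ _
        _ = μ * ‖(T ^ n) x‖ + ‖(T ^ n) ((T - μ • (1 : End ℝ V)) x)‖ := by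
          rw [norm_smul, Real.norm_of_nonneg hμ]
        _ ≤ μ * (C * r ^ n) + C * (r - μ) * r ^ n := by
          gcongr
          exact (hB n).trans (by gcongr)
        _ = C * r ^ (n + 1) := by ring

theorem tendsto_inv_pow_smul_pow_apply (T : V →ₗ[ℝ] V) {μ s : ℝ} (hμ : 0 ≤ μ) (hs : μ < s)
    {x : V} (hx : x ∈ End.maxGenEigenspace T μ) :
    Tendsto (fun n : ℕ => (s⁻¹) ^ n • (T ^ n) x) atTop (𝓝 0) := by
  obtain ⟨k, hk⟩ := (End.mem_maxGenEigenspace T μ x).1 hx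
  obtain ⟨r, hμr, hrs⟩ := exists_between hs
  obtain ⟨C, hC⟩ := exists_norm_pow_apply_le T hμ hμr k x hk
  have hr : 0 ≤ r := hμ.trans hμr.le
  have hs0 : 0 < s := hμ.trans_lt hs
  refine squeeze_zero_norm (a := fun n => C * (r / s) ^ n) (fun n => ?_) ?_
  · calc ‖(s⁻¹) ^ n • (T ^ n) x‖ = (s⁻¹) ^ n * ‖(T ^ n) x‖ := by
          rw [norm_smul, Real.norm_of_nonneg (by positivity)]
      _ ≤ (s⁻¹) ^ n * (C * r ^ n) := by gcongr; exact hC n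
      _ = C * (r / s) ^ n := by rw [div_eq_mul_inv, mul_pow]; ring
  · simpa using (tendsto_pow_atTop_nhds_zero_of_lt_one (div_nonneg hr hs0.le)
      ((div_lt_one hs0).2 hrs)).const_mul C

theorem tendsto_inv_pow_smul_pow_apply_of_mem_iSup (T : V →ₗ[ℝ] V) {σ : Finset ℝ} {s : ℝ}
    (hσ : ∀ μ ∈ σ, 0 ≤ μ ∧ μ < s) {w : V} (hw : w ∈ ⨆ μ ∈ σ, End.maxGenEigenspace T μ) :
    Tendsto (fun n : ℕ => (s⁻¹) ^ n • (T ^ n) w) atTop (𝓝 0) := by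
  let S : Submodule ℝ V :=
    { carrier := {x | Tendsto (fun n : ℕ => (s⁻¹) ^ n • (T ^ n) x) atTop (𝓝 0)}
      zero_mem' := by simp
      add_mem' := fun {x y} hx hy => by simpa using Tendsto.add hx hy
      smul_mem' := fun c x hx => by
        simpa [smul_comm c] using Tendsto.const_smul hx c }
  have hS : ⨆ μ ∈ σ, End.maxGenEigenspace T μ ≤ S := iSup₂_le fun μ hμ x hx =>
    tendsto_inv_pow_smul_pow_apply T (hσ μ hμ).1 (hσ μ hμ).2 hx
  exact hS hw

theorem exists_pos_le_norm_pow_apply [FiniteDimensional ℝ V] (T : V →ₗ[ℝ] V) {s : ℝ}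
    (hs : 0 ≤ s) (k : ℕ) :
    ∀ x : V, ((T - s • (1 : End ℝ V)) ^ k) x = 0 → x ≠ 0 →
      ∃ c : ℝ, 0 < c ∧ ∀ n : ℕ, c * s ^ n ≤ ‖(T ^ n) x‖ := by
  induction k with
  | zero => exact fun x hx hx0 => (hx0 (by simpa using hx)).elim
  | succ k ih =>
    intro x hx hx0
    by_cases hN : (T - s • (1 : End ℝ V)) x = 0
    · refine ⟨‖x‖, norm_pos_iff.2 hx0, fun n => ?_⟩
      have hTx : T x = s • x := by simpa [sub_eq_zero] using hN
      have hTn : (T ^ n) x = s ^ n • x := by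
        induction n with
        | zero => simp
        | succ n ihn => rw [pow_succ', End.mul_apply, ihn, map_smul, hTx, smul_smul, pow_succ]
      rw [hTn, norm_smul, Real.norm_of_nonneg (pow_nonneg hs n), mul_comm]
    · obtain ⟨c, hc, hcn⟩ := ih ((T - s • (1 : End ℝ V)) x) (by rwa [pow_succ] at hx) hN
      let N : V →L[ℝ] V := LinearMap.toContinuousLinearMap (T - s • (1 : End ℝ V))
      have hM : 0 < ‖N‖ + 1 := by positivity
      refine ⟨c / (‖N‖ + 1), div_pos hc hM, fun n => ?_⟩
      have hcomm : (T ^ n) ((T - s • (1 : End ℝ V)) x) = N ((T ^ n) x) := by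
        have h : Commute (T ^ n) (T - s • (1 : End ℝ V)) :=
          ((Commute.refl T).sub_right ((Commute.one_right T).smul_right s)).pow_left n
        exact LinearMap.congr_fun h.eq x
      rw [div_mul_eq_mul_div, div_le_iff₀ hM]
      calc c * s ^ n ≤ ‖N ((T ^ n) x)‖ := hcomm ▸ hcn n
        _ ≤ ‖N‖ * ‖(T ^ n) x‖ := N.le_opNorm _
        _ ≤ ‖(T ^ n) x‖ * (‖N‖ + 1) := by nlinarith [norm_nonneg ((T ^ n) x)]

end GrowthOfIterates

section ProjectiveRatio

variable {V : Type*} [NormedAddCommGroup V] [NormedSpace ℝ V]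

/-- The function `[x] ↦ ‖N x‖ / ‖x‖` on projective space. -/
noncomputable def projectiveNormRatio (N : V →L[ℝ] V) : Projectivization ℝ V → ℝ :=
  Projectivization.lift (fun x : {x : V // x ≠ 0} => ‖N x‖ / ‖(x : V)‖) <| by
    rintro ⟨x, hx⟩ ⟨y, hy⟩ t (rfl : x = t • y)
    have ht : ‖t‖ ≠ 0 := by
      rw [norm_ne_zero_iff]
      rintro rfl
      simp at hx
    simp only [map_smul, norm_smul]
    exact mul_div_mul_left _ _ ht

theorem projectiveNormRatio_mk (N : V →L[ℝ] V) (x : V) (hx : x ≠ 0) :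
    projectiveNormRatio N (Projectivization.mk ℝ x hx) = ‖N x‖ / ‖x‖ := rfl

theorem continuous_projectiveNormRatio (N : V →L[ℝ] V) : Continuous (projectiveNormRatio N) := by
  refine Continuous.quotient_lift (s := projectivizationSetoid ℝ V)
    (f := fun x : {x : V // x ≠ 0} => ‖N x‖ / ‖(x : V)‖) ?_ _
  exact (by fun_prop : Continuous fun x : {x : V // x ≠ 0} => ‖N x‖).div (by fun_prop)
    fun x => norm_ne_zero_iff.2 x.2

end ProjectiveRatio

/-- If `V` is the internal direct sum of the maximal generalized eigenspaces of `T` over a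
finite set `σ` of positive reals, `lam = max σ`, and the component of `v` in the top
generalized eigenspace `V(lam)` is nonzero, then `T ^ n v ≠ 0` for all `n` and every cluster
point of `[T ^ n v]` in `ℙ(V)` lies in `ℙ(V(lam))`. -/
theorem statement2 {V : Type*} [NormedAddCommGroup V] [NormedSpace ℝ V]
    [FiniteDimensional ℝ V] [Nontrivial V]
    (T : V →ₗ[ℝ] V) (σ : Finset ℝ) (hσpos : ∀ μ ∈ σ, 0 < μ) (hσne : σ.Nonempty)
    (hint : DirectSum.IsInternal fun μ : σ => Module.End.maxGenEigenspace T (μ : ℝ))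
    (lam : ℝ) (hlam : lam = σ.max' hσne) (v : V)
    (hv : ∃ vl ∈ Module.End.maxGenEigenspace T lam,
      ∃ w ∈ ⨆ μ ∈ σ.erase lam, Module.End.maxGenEigenspace T μ, v = vl + w ∧ vl ≠ 0) :
    ∃ hne : ∀ n : ℕ, (T ^ n) v ≠ 0,
      ∀ P : Projectivization ℝ V,
        MapClusterPt P atTop (fun n : ℕ => Projectivization.mk ℝ ((T ^ n) v) (hne n)) →
        P.submodule ≤ Module.End.maxGenEigenspace T lam := by
  obtain ⟨vl, hvl, w, hw, rfl, hvl0⟩ := hv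
  have hlam0 : 0 < lam := hσpos lam (hlam ▸ σ.max'_mem hσne)
  have hwlim : Tendsto (fun n : ℕ => (lam⁻¹) ^ n • (T ^ n) w) atTop (𝓝 0) := by
    refine tendsto_inv_pow_smul_pow_apply_of_mem_iSup T (fun μ hμ => ?_) hw
    obtain ⟨hne, hmem⟩ := Finset.mem_erase.1 hμ
    exact ⟨(hσpos μ hmem).le, lt_of_le_of_ne (hlam ▸ σ.le_max' μ hmem) hne⟩
  obtain ⟨k, hk⟩ := (End.mem_maxGenEigenspace T lam vl).1 hvl
  obtain ⟨c, hc, hcn⟩ := exists_pos_le_norm_pow_apply T hlam0.le k vl hk hvl0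
  have hlower : ∀ᶠ n : ℕ in atTop, c / 2 ≤ ‖(lam⁻¹) ^ n • (T ^ n) (vl + w)‖ := by
    filter_upwards [hwlim.norm.eventually_lt_const (u := c / 2) (by simpa using half_pos hc)] with n hn
    have hcvl : c ≤ ‖(lam⁻¹) ^ n • (T ^ n) vl‖ := by
      rw [norm_smul, Real.norm_of_nonneg (by positivity), inv_pow, inv_mul_eq_div,
        le_div_iff₀ (by positivity)]
      exact hcn n
    have htri := norm_sub_le_norm_add ((lam⁻¹) ^ n • (T ^ n) vl) ((lam⁻¹) ^ n • (T ^ n) w)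
    rw [map_add, smul_add]
    linarith
  have hne : ∀ n : ℕ, (T ^ n) (vl + w) ≠ 0 := by
    intro n hn
    obtain ⟨m, hm, hnm⟩ := (hlower.and (eventually_ge_atTop n)).exists
    obtain ⟨j, rfl⟩ := Nat.exists_eq_add_of_le' hnm
    rw [pow_add T, End.mul_apply, hn, map_zero, smul_zero, norm_zero] at hm
    linarith
  refine ⟨hne, fun P hP => ?_⟩
  let N : V →L[ℝ] V :=
    LinearMap.toContinuousLinearMap ((T - lam • (1 : End ℝ V)) ^ finrank ℝ V)
  have hker : ∀ x, x ∈ End.maxGenEigenspace T lam ↔ N x = 0 := fun x => by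
    rw [End.maxGenEigenspace_eq_genEigenspace_finrank, End.mem_genEigenspace_nat]
    exact Iff.rfl
  have hratio : Tendsto (fun n : ℕ => projectiveNormRatio N
      (Projectivization.mk ℝ ((T ^ n) (vl + w)) (hne n))) atTop (𝓝 0) := by
    have hnum : Tendsto (fun n : ℕ => ‖N ((lam⁻¹) ^ n • (T ^ n) w)‖ / (c / 2)) atTop (𝓝 0) := by
      simpa using (((N.continuous.tendsto 0).comp hwlim).norm).div_const (c / 2)
    refine squeeze_zero' (Eventually.of_forall fun n => ?_) ?_ hnum
    · rw [projectiveNormRatio_mk]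
      positivity
    · filter_upwards [hlower] with n hn
      have hNvl : N ((T ^ n) vl) = 0 := (hker _).1 <|
        End.mapsTo_maxGenEigenspace_of_comm ((Commute.refl T).pow_right n) lam hvl
      have hpos : 0 < ‖(lam⁻¹) ^ n‖ := norm_pos_iff.2 (by positivity)
      rw [projectiveNormRatio_mk, ← mul_div_mul_left _ _ hpos.ne', ← norm_smul, ← norm_smul,
        ← map_smul]
      have hNv : N ((lam⁻¹) ^ n • (T ^ n) (vl + w)) = N ((lam⁻¹) ^ n • (T ^ n) w) := by
        simp [hNvl]
      rw [hNv]
      gcongr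
  have hP0 : projectiveNormRatio N P = 0 := by
    have hclus := hP.continuousAt_comp (continuous_projectiveNormRatio N).continuousAt
    exact eq_of_nhds_neBot (hclus.neBot.mono (inf_le_inf_left _ hratio))
  induction P with
  | h x hx =>
    rw [projectiveNormRatio_mk, div_eq_zero_iff, norm_eq_zero,
      or_iff_left (norm_ne_zero_iff.2 hx)] at hP0
    rw [Projectivization.submodule_mk, Submodule.span_singleton_le_iff_mem]
    exact (hker x).2 hP0
end

section
/- Let E be a finite-dimensional real normed vector space and L a full lattice in E, i.e., a discrete additive subgroup of E whose ℝ-linear span is all of E. Let C ⊆ E be a nonempty open set which is stable under dilations by scalars at least one: t • x ∈ C whenever x ∈ C and t ≥ 1. Then L ∩ C ≠ ∅. -/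
/-- An additive subgroup spanning `E` over `ℝ` lies within bounded distance of every point. -/
theorem exists_mem_norm_sub_le_of_span_eq_top {E : Type*} [NormedAddCommGroup E]
    [NormedSpace ℝ E] [FiniteDimensional ℝ E] (L : AddSubgroup E)
    (hspan : Submodule.span ℝ (L : Set E) = ⊤) :
    ∃ M : ℝ, ∀ x : E, ∃ v ∈ L, ‖x - v‖ ≤ M := by
  let b := Module.Basis.ofSpan hspan.ge
  have hb : Set.range b ⊆ L := Module.Basis.ofSpan_subset hspan.ge
  let _ := FiniteDimensional.fintypeBasisIndex b
  refine ⟨∑ i, ‖b i‖, fun x ↦ ⟨ZSpan.floor b x, ?_, ZSpan.norm_fract_le b x⟩⟩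
  have hle : Submodule.span ℤ (Set.range b) ≤ AddSubgroup.toIntSubmodule L :=
    Submodule.span_le.2 hb
  exact hle (ZSpan.floor b x).2

/-- A full lattice `L` (a discrete additive subgroup spanning `E` over `ℝ`) in a
finite-dimensional real normed space meets every nonempty open set that is stable under
dilations by scalars `t ≥ 1`. -/
theorem statement7 {E : Type*} [NormedAddCommGroup E] [NormedSpace ℝ E]
    [FiniteDimensional ℝ E]
    (L : AddSubgroup E) (hdisc : DiscreteTopology L)
    (hspan : Submodule.span ℝ (L : Set E) = ⊤)
    (C : Set E) (hCopen : IsOpen C) (hCne : C.Nonempty)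
    (hdil : ∀ x ∈ C, ∀ t : ℝ, 1 ≤ t → t • x ∈ C) :
    ((L : Set E) ∩ C).Nonempty := by
  obtain ⟨M, hM⟩ := exists_mem_norm_sub_le_of_span_eq_top L hspan
  obtain ⟨x, hx⟩ := hCne
  obtain ⟨ε, hε, hball⟩ := Metric.isOpen_iff.1 hCopen x hx
  obtain ⟨t, ht⟩ := exists_gt (max 1 (M / ε))
  obtain ⟨ht1, htM⟩ := max_lt_iff.1 ht
  have ht0 : 0 < t := one_pos.trans ht1
  obtain ⟨v, hvL, hv⟩ := hM (t • x)
  have hmem : t⁻¹ • v ∈ C := by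
    apply hball
    have hsub : x - t⁻¹ • v = t⁻¹ • (t • x - v) := by
      rw [smul_sub, inv_smul_smul₀ ht0.ne']
    rw [Metric.mem_ball, dist_eq_norm', hsub, norm_smul, norm_inv,
      Real.norm_of_nonneg ht0.le, inv_mul_lt_iff₀ ht0]
    exact hv.trans_lt ((div_lt_iff₀ hε).1 htM)
  refine ⟨v, hvL, ?_⟩
  simpa only [smul_inv_smul₀ ht0.ne'] using hdil _ hmem t ht1.le
end

section
/- Let (M, d) be a metric space, h : M → M a bijective isometry, and g : M → M a map commuting with h (h ∘ g = g ∘ h); set f = h ∘ g. Let s ∈ M and ε₀ > 0 be such that for every ε > 0 there exists N with f^[n](B(s, ε₀)) ⊆ B(s, ε) for all n ≥ N (s is a topological sink of f whose basin contains the open ball B(s, ε₀)). Let (n_i) be a sequence of natural numbers with n_i → ∞ such that (h⁻¹)^[n_i](s) → s. Then for every ε > 0 and all sufficiently large i, g^[n_i](B(s, ε₀)) ⊆ B(s, 2ε); that is, s is a topological sink for the sequence of maps g^[n_i]. -/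
open Filter Topology Metric

/-- The iterates of an isometry are isometries. -/
theorem Isometry.iterate {α : Type*} [PseudoEMetricSpace α] {f : α → α} (hf : Isometry f) :
    ∀ n : ℕ, Isometry f^[n]
  | 0 => isometry_id
  | n + 1 => (hf.iterate n).comp hf

/-- If `f = h ∘ g` with `h` a bijective isometry commuting with `g`, `s` is a topological sink
of `f` whose basin contains `B(s, ε₀)`, and `n_i → ∞` is such that `(h⁻¹)^[n_i] s → s`, then
`s` is a topological sink for the sequence of maps `g^[n_i]`:
for every `ε > 0`, eventually `g^[n_i](B(s, ε₀)) ⊆ B(s, 2ε)`. -/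
theorem statement10 {M : Type*} [MetricSpace M] (h g : M → M)
    (hiso : Isometry h) (hbij : Function.Bijective h)
    (hinv : M → M) (hli : Function.LeftInverse hinv h) (hri : Function.RightInverse hinv h)
    (hcomm : h ∘ g = g ∘ h)
    (s : M) (ε₀ : ℝ) (hε₀ : 0 < ε₀)
    (hsink : ∀ ε > 0, ∃ N : ℕ, ∀ n ≥ N, (h ∘ g)^[n] '' ball s ε₀ ⊆ ball s ε)
    (n : ℕ → ℕ) (hn : Tendsto n atTop atTop)
    (hret : Tendsto (fun i => hinv^[n i] s) atTop (𝓝 s)) :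
    ∀ ε > 0, ∀ᶠ i in atTop, g^[n i] '' ball s ε₀ ⊆ ball s (2 * ε) := by
  intro ε hε
  obtain ⟨N, hN⟩ := hsink ε hε
  filter_upwards [hn.eventually_ge_atTop N, hret.eventually (ball_mem_nhds s hε)] with i hi hs
  rintro _ ⟨x, hx, rfl⟩
  have hf : dist ((h ∘ g)^[n i] x) s < ε := hN _ hi (Set.mem_image_of_mem _ hx)
  have hcomm' : Function.Commute h g := fun y => congrFun hcomm y
  rw [hcomm'.comp_iterate, Function.comp_apply, ← hri.iterate (n i) s,
    (hiso.iterate (n i)).dist_eq] at hf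
  calc dist (g^[n i] x) s
      ≤ dist (g^[n i] x) (hinv^[n i] s) + dist (hinv^[n i] s) s := dist_triangle _ _ _
    _ < ε + ε := add_lt_add hf hs
    _ = 2 * ε := (two_mul ε).symm
end
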